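/- Let N be a natural number and let L(σ) denote the length of the longest increasing subsequence of a permutation σ of {1,…,N}. For every ℓ, the number of permutations σ of {1,…,N} with L(σ) = ℓ equals the sum, over all partitions λ of N whose first (largest) part λ₁ equals ℓ, of the square of the number of standard Young tableaux of shape λ. Equivalently, if σ is chosen uniformly at random among the N! permutations, then Prob(L(σ) = ℓ) = Σ_{λ ⊢ N, λ₁ = ℓ} (f_λ)² / N!, where f_λ is the number of standard Young tableaux of shape λ. -/

import Mathlib

open Finset Nat

/-- The length of the longest increasing subsequence of a permutation `σ` of `{1,…,N}`
(represented as a permutation of `Fin N`): the largest `k` for which there is a strictly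
increasing sequence of `k` indices along which the values of `σ` strictly increase. -/
noncomputable def lisLength {N : ℕ} (σ : Equiv.Perm (Fin N)) : ℕ :=
  sSup {k : ℕ | ∃ f : Fin k → Fin N, StrictMono f ∧ StrictMono (fun i => σ (f i))}

/-- The number of standard Young tableaux of shape `μ`: bijective fillings of the cells of `μ`
by the numbers `{1,…,|μ|}` (represented as `Fin μ.card`) which strictly increase along each
row (left to right) and down each column. -/
noncomputable def sytCount (μ : YoungDiagram) : ℕ :=
  Nat.card {f : μ.cells → Fin μ.card // Function.Bijective f ∧
    (∀ c₁ c₂ : μ.cells, (c₁ : ℕ × ℕ).1 = (c₂ : ℕ × ℕ).1 → (c₁ : ℕ × ℕ).2 < (c₂ : ℕ × ℕ).2 →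
      f c₁ < f c₂) ∧
    (∀ c₁ c₂ : μ.cells, (c₁ : ℕ × ℕ).2 = (c₂ : ℕ × ℕ).2 → (c₁ : ℕ × ℕ).1 < (c₂ : ℕ × ℕ).1 →
      f c₁ < f c₂)}

namespace YoungDiagram

/-- `AddsBox a b i` says that `b` is obtained from `a` by adding one box at the end of row `i`. -/
def AddsBox (a b : YoungDiagram) (i : ℕ) : Prop :=
  ∀ k, b.rowLen k = a.rowLen k + if k = i then 1 else 0

/-- `Step a b` says that `b` is obtained from `a` by adding at most one box. -/
def Step (a b : YoungDiagram) : Prop := a = b ∨ ∃ i, AddsBox a b i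

theorem ext_rowLen {a b : YoungDiagram} (h : ∀ k, a.rowLen k = b.rowLen k) : a = b := by
  refine YoungDiagram.ext (Finset.ext fun ⟨i, j⟩ => ?_)
  rw [mem_cells, mem_cells, mem_iff_lt_rowLen, mem_iff_lt_rowLen, h]

theorem le_iff_rowLen {a b : YoungDiagram} : a ≤ b ↔ ∀ k, a.rowLen k ≤ b.rowLen k := by
  constructor
  · intro h k
    by_contra! hk
    exact lt_irrefl _ (mem_iff_lt_rowLen.1 (h (mem_iff_lt_rowLen.2 hk)))
  · rintro h ⟨i, j⟩ hc
    exact mem_iff_lt_rowLen.2 ((mem_iff_lt_rowLen.1 hc).trans_le (h i))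

theorem exists_rowLen_eq_zero (a : YoungDiagram) : ∃ K, a.rowLen K = 0 := by
  refine ⟨a.colLen 0, ?_⟩
  by_contra h
  exact lt_irrefl _ (mem_iff_lt_colLen.1 (mem_iff_lt_rowLen.2 (Nat.pos_of_ne_zero h)))

theorem exists_rowLen_eq {r : ℕ → ℕ} (hr : Antitone r) (h0 : ∃ K, r K = 0) :
    ∃ a : YoungDiagram, ∀ k, a.rowLen k = r k := by
  obtain ⟨K, hK⟩ := h0
  let a : YoungDiagram :=
    { cells := (Finset.range K ×ˢ Finset.range (r 0)).filter fun c => c.2 < r c.1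
      isLowerSet := by
        rintro ⟨i, j⟩ ⟨i', j'⟩ ⟨h1, h2⟩ h
        simp only [Finset.coe_filter, Finset.mem_product, Finset.mem_range,
          Set.mem_ofPred_eq] at h h1 h2 ⊢
        have := hr h1
        omega }
  have ha : ∀ i j, (i, j) ∈ a ↔ j < r i := by
    intro i j
    rw [← mem_cells]
    simp only [a, Finset.mem_filter, Finset.mem_product, Finset.mem_range]
    refine ⟨fun h => h.2, fun h => ⟨⟨?_, h.trans_le (hr (Nat.zero_le _))⟩, h⟩⟩
    by_contra! hi
    have := hr hi
    omega
  refine ⟨a, fun k => eq_of_forall_lt_iff fun j => ?_⟩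
  rw [← ha, mem_iff_lt_rowLen]

namespace AddsBox

variable {a a' b b' : YoungDiagram} {i j : ℕ}

theorem rowLen_self (h : AddsBox a b i) : b.rowLen i = a.rowLen i + 1 := by simp [h i]

theorem rowLen_of_ne (h : AddsBox a b i) {k : ℕ} (hk : k ≠ i) : b.rowLen k = a.rowLen k := by
  simp [h k, hk]

theorem ne (h : AddsBox a b i) : a ≠ b := by
  rintro rfl
  have := h.rowLen_self
  omega

theorem index_unique (h : AddsBox a b i) (h' : AddsBox a b j) : i = j := by
  by_contra hij
  have h1 := h.rowLen_self
  have h2 := h'.rowLen_of_ne hij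
  omega

theorem right_unique (h : AddsBox a b i) (h' : AddsBox a b' i) : b = b' :=
  ext_rowLen fun k => (h k).trans (h' k).symm

theorem left_unique (h : AddsBox a b i) (h' : AddsBox a' b i) : a = a' :=
  ext_rowLen fun k => by have h1 := h k; have h2 := h' k; omega

theorem le (h : AddsBox a b i) : a ≤ b := le_iff_rowLen.2 fun k => by rw [h k]; omega

theorem card (h : AddsBox a b i) : b.card = a.card + 1 := by
  have hc : b.cells = insert (i, a.rowLen i) a.cells := by
    ext ⟨k, l⟩
    rw [Finset.mem_insert, mem_cells, mem_cells, mem_iff_lt_rowLen, mem_iff_lt_rowLen, h k,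
      Prod.mk.injEq]
    split_ifs with hk
    · subst hk; omega
    · simp [hk]
  rw [YoungDiagram.card, hc, Finset.card_insert_of_notMem]
  rw [mem_cells, mem_iff_lt_rowLen]
  exact lt_irrefl _

end AddsBox

theorem exists_addsBox_right {a : YoungDiagram} {i : ℕ}
    (h : ∀ k < i, a.rowLen i < a.rowLen k) : ∃ b, AddsBox a b i := by
  refine exists_rowLen_eq (r := fun k => a.rowLen k + if k = i then 1 else 0) ?_ ?_
  · intro k l hkl
    have h1 := a.rowLen_anti k l hkl
    have h2 := h k
    dsimp only
    split_ifs <;> subst_vars <;> omega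
  · obtain ⟨K, hK⟩ := a.exists_rowLen_eq_zero
    refine ⟨K + i + 1, ?_⟩
    have := a.rowLen_anti K (K + i + 1) (by omega)
    rw [if_neg (by omega)]
    omega

theorem exists_addsBox_left {b : YoungDiagram} {i : ℕ}
    (h : b.rowLen (i + 1) < b.rowLen i) : ∃ a, AddsBox a b i := by
  have hr : Antitone fun k => b.rowLen k - if k = i then 1 else 0 := by
    intro k l hkl
    have h1 := b.rowLen_anti k l hkl
    dsimp only
    by_cases hk : k = i
    · subst hk
      by_cases hl : l = k
      · subst hl; exact le_rfl
      · have := b.rowLen_anti (k + 1) l (by omega)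
        simp only [hl, if_true, if_false]
        omega
    · simp only [hk, if_false]
      omega
  obtain ⟨K, hK⟩ := b.exists_rowLen_eq_zero
  obtain ⟨a, ha⟩ := exists_rowLen_eq hr ⟨K, by simp [hK]⟩
  refine ⟨a, fun k => ?_⟩
  rw [ha]
  split_ifs <;> subst_vars <;> omega

theorem step_of_le_of_card {a b : YoungDiagram} (h : a ≤ b) (hc : b.card = a.card + 1) :
    Step a b := by
  have hsub : a.cells ⊆ b.cells := cells_subset_iff.2 h
  have h1 : (b.cells \ a.cells).card = 1 := by
    rw [Finset.card_sdiff_of_subset hsub]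
    simp only [YoungDiagram.card] at hc
    omega
  obtain ⟨⟨r, s⟩, hrs⟩ := Finset.card_eq_one.1 h1
  have key : ∀ k l, (l < b.rowLen k ∧ ¬ l < a.rowLen k) ↔ k = r ∧ l = s := by
    intro k l
    have := Finset.ext_iff.1 hrs (k, l)
    simpa only [Finset.mem_sdiff, mem_cells, mem_iff_lt_rowLen, Finset.mem_singleton,
      Prod.mk.injEq] using this
  refine Or.inr ⟨r, fun k => ?_⟩
  have hle := le_iff_rowLen.1 h k
  by_cases hk : k = r
  · subst hk
    have h2 := (key k s).2 ⟨rfl, rfl⟩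
    have h3 := key k (a.rowLen k)
    have h4 := key k (a.rowLen k + 1)
    simp only [if_true]
    omega
  · have h3 := key k (a.rowLen k)
    simp only [hk, if_false]
    omega

namespace Step

variable {a b c : YoungDiagram}

theorem refl (a : YoungDiagram) : Step a a := Or.inl rfl

theorem le (h : Step a b) : a ≤ b := by
  rcases h with rfl | ⟨i, h⟩
  exacts [le_rfl, h.le]

end Step

/-- Fomin's local rule for growth diagrams: `a`, `b`, `c`, `d` are the diagrams at the corners of
a unit square, with `a` at the origin and `d` opposite to it, and `x ∈ {0, 1}` is the entry of the
square. -/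
inductive LocalRule : YoungDiagram → YoungDiagram → YoungDiagram → YoungDiagram → ℕ → Prop
  | const (a) : LocalRule a a a a 0
  | cross {a d} : AddsBox a d 0 → LocalRule a a a d 1
  | fst {a b i} : AddsBox a b i → LocalRule a b a b 0
  | snd {a c i} : AddsBox a c i → LocalRule a a c c 0
  | join {a b c d i j} : i ≠ j → AddsBox a b i → AddsBox a c j → AddsBox b d j → AddsBox c d i →
      LocalRule a b c d 0
  | bump {a b d i} : AddsBox a b i → AddsBox b d (i + 1) → LocalRule a b b d 0

namespace LocalRule

variable {a a' b c d d' : YoungDiagram} {x x' : ℕ}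

theorem symm (h : LocalRule a b c d x) : LocalRule a c b d x := by
  cases h with
  | const => exact const _
  | cross h => exact cross h
  | fst h => exact snd h
  | snd h => exact fst h
  | join hij h1 h2 h3 h4 => exact join hij.symm h2 h1 h4 h3
  | bump h1 h2 => exact bump h1 h2

theorem step_fst (h : LocalRule a b c d x) : Step a b := by
  cases h with
  | const => exact .refl _
  | cross h => exact .refl _
  | fst h => exact .inr ⟨_, h⟩
  | snd h => exact .refl _
  | join hij h1 h2 h3 h4 => exact .inr ⟨_, h1⟩
  | bump h1 h2 => exact .inr ⟨_, h1⟩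

theorem step_snd (h : LocalRule a b c d x) : Step a c := h.symm.step_fst

theorem step_fst_top (h : LocalRule a b c d x) : Step b d := by
  cases h with
  | const => exact .refl _
  | cross h => exact .inr ⟨_, h⟩
  | fst h => exact .refl _
  | snd h => exact .inr ⟨_, h⟩
  | join hij h1 h2 h3 h4 => exact .inr ⟨_, h3⟩
  | bump h1 h2 => exact .inr ⟨_, h2⟩

theorem step_snd_top (h : LocalRule a b c d x) : Step c d := h.symm.step_fst_top

theorem card (h : LocalRule a b c d x) : a.card + d.card = b.card + c.card + x := by
  cases h with
  | const => rfl
  | cross h => rw [h.card]; ring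
  | fst h => ring
  | snd h => ring
  | join hij h1 h2 h3 h4 => rw [h3.card, h2.card]; ring
  | bump h1 h2 => rw [h2.card, h1.card]; ring

theorem entry_le_one (h : LocalRule a b c d x) : x ≤ 1 := by cases h <;> simp

theorem rowLen_zero (h : LocalRule a b c d x) :
    d.rowLen 0 = max (b.rowLen 0) (c.rowLen 0) + x := by
  cases h with
  | const => simp
  | cross h => simp [h.rowLen_self]
  | fst h => simpa using le_iff_rowLen.1 h.le 0
  | snd h => simpa using le_iff_rowLen.1 h.le 0
  | join hij h1 h2 h3 h4 =>
    have e1 := h1 0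
    have e2 := h2 0
    have e3 := h3 0
    split_ifs at * <;> omega
  | bump h1 h2 => simp [h2.rowLen_of_ne (Nat.succ_ne_zero _).symm]

theorem eq_of_entry_eq_one (h : LocalRule a b c d 1) : a = b ∧ a = c := by
  cases h; exact ⟨rfl, rfl⟩

theorem top_eq_of_eq (h : LocalRule a a c d 0) : d = c := by
  cases h with
  | const => rfl
  | fst h => exact absurd rfl h.ne
  | snd h => rfl
  | join hij h1 h2 h3 h4 => exact absurd rfl h1.ne
  | bump h1 h2 => exact absurd rfl h1.ne

theorem exists_top (hb : Step a b) (hc : Step a c) (hx : x ≤ 1) (h1 : x = 1 → a = b ∧ a = c) :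
    ∃ d, LocalRule a b c d x := by
  obtain rfl | rfl : x = 0 ∨ x = 1 := by omega
  · rcases hb with rfl | ⟨i, hi⟩
    · rcases hc with rfl | ⟨j, hj⟩
      exacts [⟨_, const _⟩, ⟨_, snd hj⟩]
    · rcases hc with rfl | ⟨j, hj⟩
      · exact ⟨_, fst hi⟩
      · by_cases hij : i = j
        · subst hij
          obtain rfl := hi.right_unique hj
          obtain ⟨d, hd⟩ := exists_addsBox_right (a := b) (i := i + 1) fun k hk => by
            have e1 := hi.rowLen_of_ne (k := i + 1) (by omega)
            have e2 := hi k
            have e3 := a.rowLen_anti k (i + 1) (by omega)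
            have e4 := a.rowLen_anti k i (by omega)
            have e5 := b.rowLen_anti k i (by omega)
            have e6 := hi.rowLen_self
            have e7 := a.rowLen_anti i (i + 1) (by omega)
            omega
          exact ⟨d, bump hi hd⟩
        · obtain ⟨d, hd⟩ := exists_rowLen_eq (r := fun k => max (b.rowLen k) (c.rowLen k))
            (fun k l hkl => max_le_max (b.rowLen_anti k l hkl) (c.rowLen_anti k l hkl)) (by
              obtain ⟨K, hK⟩ := b.exists_rowLen_eq_zero
              obtain ⟨L, hL⟩ := c.exists_rowLen_eq_zero
              have := b.rowLen_anti K (K + L) (by omega)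
              have := c.rowLen_anti L (K + L) (by omega)
              exact ⟨K + L, by omega⟩)
          refine ⟨d, join hij hi hj (fun k => ?_) (fun k => ?_)⟩ <;>
          · have e1 := hi k
            have e2 := hj k
            rw [hd]
            split_ifs at * <;> omega
  · obtain ⟨rfl, rfl⟩ := h1 rfl
    obtain ⟨d, hd⟩ := exists_addsBox_right (a := a) (i := 0) (by simp)
    exact ⟨d, cross hd⟩

theorem exists_bot (hb : Step b d) (hc : Step c d) : ∃ a x, LocalRule a b c d x := by
  rcases hb with rfl | ⟨i, hi⟩
  · rcases hc with rfl | ⟨j, hj⟩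
    exacts [⟨_, _, const _⟩, ⟨_, _, fst hj⟩]
  · rcases hc with rfl | ⟨j, hj⟩
    · exact ⟨_, _, snd hi⟩
    · by_cases hij : i = j
      · subst hij
        obtain rfl := hi.left_unique hj
        rcases i with _ | i
        · exact ⟨_, _, cross hi⟩
        · obtain ⟨a, ha⟩ := exists_addsBox_left (b := b) (i := i) (by
            have e1 := hi.rowLen_self
            have e2 := hi.rowLen_of_ne (k := i) (by omega)
            have e3 := d.rowLen_anti i (i + 1) (by omega)
            omega)
          exact ⟨_, _, bump ha hi⟩
      · obtain ⟨a, ha⟩ := exists_rowLen_eq (r := fun k => min (b.rowLen k) (c.rowLen k))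
          (fun k l hkl => min_le_min (b.rowLen_anti k l hkl) (c.rowLen_anti k l hkl)) (by
            obtain ⟨K, hK⟩ := b.exists_rowLen_eq_zero
            exact ⟨K, by simp [hK]⟩)
        refine ⟨a, 0, join (i := j) (j := i) (Ne.symm hij) (fun k => ?_) (fun k => ?_) hi hj⟩ <;>
        · have e1 := hi k
          have e2 := hj k
          rw [ha]
          split_ifs at * <;> omega

theorem top_unique (h : LocalRule a b c d x) (h' : LocalRule a b c d' x) : d = d' := by
  cases h with
  | const => exact h'.top_eq_of_eq.symm
  | cross h => cases h' with | cross h' => exact h.right_unique h'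
  | fst h => exact h'.symm.top_eq_of_eq.symm
  | snd h => exact h'.top_eq_of_eq.symm
  | join hij h1 h2 h3 h4 =>
    cases h' with
    | const => exact absurd rfl h1.ne
    | fst h => exact absurd rfl h2.ne
    | snd h => exact absurd rfl h1.ne
    | join hij' h1' h2' h3' h4' =>
      obtain rfl := h2.index_unique h2'
      exact h3.right_unique h3'
    | bump h1' h2' => exact absurd (h1.index_unique h2) hij
  | bump h1 h2 =>
    cases h' with
    | const => exact absurd rfl h1.ne
    | fst h => exact absurd rfl h1.ne
    | snd h => exact absurd rfl h1.ne
    | join hij' h1' h2' h3' h4' => exact absurd (h1'.index_unique h2') hij'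
    | bump h1' h2' =>
      obtain rfl := h1.index_unique h1'
      exact h2.right_unique h2'

theorem bot_unique (h : LocalRule a b c d x) (h' : LocalRule a' b c d x') :
    a = a' ∧ x = x' := by
  cases h with
  | const =>
    cases h' with
    | const => exact ⟨rfl, rfl⟩
    | cross h' => exact absurd rfl h'.ne
    | fst h' => exact absurd rfl h'.ne
    | snd h' => exact absurd rfl h'.ne
    | join hij h1 h2 h3 h4 => exact absurd rfl h3.ne
    | bump h1 h2 => exact absurd rfl h2.ne
  | cross h =>
    cases h' with
    | const => exact absurd rfl h.ne
    | cross h' => exact ⟨rfl, rfl⟩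
    | fst h' => exact absurd rfl h'.ne
    | snd h' => exact absurd rfl h'.ne
    | join hij h1 h2 h3 h4 => exact absurd (h4.index_unique h3) hij
    | bump h1 h2 => exact absurd (h2.index_unique h) (Nat.succ_ne_zero _)
  | fst h =>
    cases h' with
    | const => exact absurd rfl h.ne
    | cross h' => exact absurd rfl h.ne
    | fst h' => exact ⟨rfl, rfl⟩
    | snd h' => exact absurd rfl h.ne
    | join hij h1 h2 h3 h4 => exact absurd rfl h3.ne
    | bump h1 h2 => exact absurd rfl h2.ne
  | snd h =>
    cases h' with
    | const => exact absurd rfl h.ne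
    | cross h' => exact absurd rfl h.ne
    | fst h' => exact absurd rfl h.ne
    | snd h' => exact ⟨rfl, rfl⟩
    | join hij h1 h2 h3 h4 => exact absurd rfl h4.ne
    | bump h1 h2 => exact absurd rfl h2.ne
  | join hij h1 h2 h3 h4 =>
    cases h' with
    | const => exact absurd rfl h3.ne
    | cross h' => exact absurd (h4.index_unique h3) hij
    | fst h' => exact absurd rfl h3.ne
    | snd h' => exact absurd rfl h4.ne
    | join hij' h1' h2' h3' h4' =>
      obtain rfl := h4.index_unique h4'
      exact ⟨h1.left_unique h1', rfl⟩
    | bump h1' h2' => exact absurd (h4.index_unique h3) hij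
  | bump h1 h2 =>
    cases h' with
    | const => exact absurd rfl h2.ne
    | cross h' => exact absurd (h2.index_unique h') (Nat.succ_ne_zero _)
    | fst h' => exact absurd rfl h2.ne
    | snd h' => exact absurd rfl h2.ne
    | join hij' h1' h2' h3' h4' => exact absurd (h4'.index_unique h3') hij'
    | bump h1' h2' =>
      obtain rfl : _ = _ := Nat.succ_injective (h2.index_unique h2')
      exact ⟨h1.left_unique h1', rfl⟩

end LocalRule

/-- `IsGrowth x Λ` says that `Λ` is the growth diagram of the matrix `x`. -/
structure IsGrowth (x : ℕ → ℕ → ℕ) (Λ : ℕ → ℕ → YoungDiagram) : Prop where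
  zero_left : ∀ j, Λ 0 j = ⊥
  zero_right : ∀ i, Λ i 0 = ⊥
  rule : ∀ i j, LocalRule (Λ i j) (Λ (i + 1) j) (Λ i (j + 1)) (Λ (i + 1) (j + 1)) (x i j)

namespace IsGrowth

variable {x : ℕ → ℕ → ℕ} {Λ Λ' : ℕ → ℕ → YoungDiagram}

theorem transpose (h : IsGrowth x Λ) : IsGrowth (fun i j => x j i) (fun i j => Λ j i) :=
  ⟨h.zero_right, h.zero_left, fun i j => (h.rule j i).symm⟩

theorem card_bot : (⊥ : YoungDiagram).card = 0 := by simp [YoungDiagram.card]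

theorem card_succ (h : IsGrowth x Λ) (i j : ℕ) :
    (Λ (i + 1) j).card = (Λ i j).card + ∑ b ∈ Finset.range j, x i b := by
  induction j with
  | zero => simp [h.zero_right]
  | succ j ih =>
    have := (h.rule i j).card
    rw [Finset.sum_range_succ]
    omega

theorem step_left (h : IsGrowth x Λ) (i j : ℕ) : Step (Λ i j) (Λ (i + 1) j) :=
  (h.rule i j).step_fst

theorem monotone_left (h : IsGrowth x Λ) (j : ℕ) : Monotone fun i => Λ i j :=
  monotone_nat_of_le_succ fun i => (h.step_left i j).le

theorem unique (h : IsGrowth x Λ) (h' : IsGrowth x Λ') : Λ = Λ' := by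
  have key : ∀ i j, Λ i j = Λ' i j := by
    intro i
    induction i with
    | zero => intro j; rw [h.zero_left, h'.zero_left]
    | succ i ih =>
      intro j
      induction j with
      | zero => rw [h.zero_right, h'.zero_right]
      | succ j ihj =>
        have h1 := h.rule i j
        rw [ih, ih, ihj] at h1
        exact h1.top_unique (h'.rule i j)
  exact funext fun i => funext (key i)

theorem eq_of_boundary {x' : ℕ → ℕ → ℕ} (h : IsGrowth x Λ) (h' : IsGrowth x' Λ') {N : ℕ}
    (hN : ∀ j, Λ N j = Λ' N j) (hN' : ∀ i, Λ i N = Λ' i N) :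
    ∀ i < N, ∀ j < N, x i j = x' i j := by
  have key : ∀ d i j, i ≤ N → j ≤ N → (N - i) + (N - j) = d → Λ i j = Λ' i j := by
    intro d
    induction d using Nat.strong_induction_on with
    | _ d ih =>
      intro i j hi hj hd
      rcases hi.eq_or_lt with rfl | hi
      · exact hN j
      rcases hj.eq_or_lt with rfl | hj
      · exact hN' i
      have h1 := h.rule i j
      rw [ih _ (by omega) (i + 1) j (by omega) (by omega) rfl,
        ih _ (by omega) i (j + 1) (by omega) (by omega) rfl,
        ih _ (by omega) (i + 1) (j + 1) (by omega) (by omega) rfl] at h1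
      exact (h1.bot_unique (h'.rule i j)).1
  intro i hi j hj
  have h1 := h.rule i j
  rw [key _ (i + 1) j (by omega) (by omega) rfl, key _ i (j + 1) (by omega) (by omega) rfl,
    key _ (i + 1) (j + 1) (by omega) (by omega) rfl] at h1
  exact (h1.bot_unique (h'.rule i j)).2

end IsGrowth

/-- The growth diagram of a matrix, defined by iterating the local rule. -/
noncomputable def growth (x : ℕ → ℕ → ℕ) : ℕ → ℕ → YoungDiagram
  | 0, _ => ⊥
  | _ + 1, 0 => ⊥
  | i + 1, j + 1 => Classical.epsilon fun d =>
      LocalRule (growth x i j) (growth x (i + 1) j) (growth x i (j + 1)) d (x i j)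

theorem isGrowth_growth {x : ℕ → ℕ → ℕ} (hx : ∀ i j, x i j ≤ 1)
    (hrow : ∀ i j b, x i j = 1 → b < j → x i b = 0)
    (hcol : ∀ i j a, x i j = 1 → a < i → x a j = 0) : IsGrowth x (growth x) := by
  have h0 : ∀ j, growth x 0 j = ⊥ := fun j => by rw [growth]
  have h0' : ∀ i, growth x i 0 = ⊥ := fun i => by cases i <;> rw [growth]
  refine ⟨h0, h0', ?_⟩
  have key : ∀ n i j, i + j = n → LocalRule (growth x i j) (growth x (i + 1) j)
      (growth x i (j + 1)) (growth x (i + 1) (j + 1)) (x i j) := by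
    intro n
    induction n using Nat.strong_induction_on with
    | _ n ih =>
      intro i j hn
      rw [growth.eq_3]
      refine Classical.epsilon_spec (LocalRule.exists_top ?_ ?_ (hx i j) fun h1 => ⟨?_, ?_⟩)
      · cases j with
        | zero => rw [h0', h0']; exact .refl _
        | succ j => exact (ih (i + j) (by omega) i j rfl).step_snd_top
      · cases i with
        | zero => rw [h0, h0]; exact .refl _
        | succ i => exact (ih (i + j) (by omega) i j rfl).step_fst_top
      · have : ∀ b ≤ j, growth x i b = growth x (i + 1) b := by
          intro b hb
          induction b with
          | zero => rw [h0', h0']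
          | succ b ihb =>
            have h2 := ih (i + b) (by omega) i b rfl
            rw [← ihb (by omega), hrow i j b h1 hb] at h2
            exact h2.top_eq_of_eq.symm
        exact this j le_rfl
      · have : ∀ a ≤ i, growth x a j = growth x a (j + 1) := by
          intro a ha
          induction a with
          | zero => rw [h0, h0]
          | succ a iha =>
            have h2 := (ih (a + j) (by omega) a j rfl).symm
            rw [← iha (by omega), hcol i j a h1 ha] at h2
            exact h2.top_eq_of_eq.symm
        exact this i le_rfl
  exact fun i j => key _ i j rfl

/-- `IsChain N P` says that `P 0 ⊆ ⋯ ⊆ P N` is a saturated chain of Young diagrams starting at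
`⊥`, extended to all of `ℕ` by the constant value `P N`. -/
structure IsChain (N : ℕ) (P : ℕ → YoungDiagram) : Prop where
  mono : Monotone P
  card : ∀ i ≤ N, (P i).card = i
  const : ∀ i, N ≤ i → P i = P N

namespace IsChain

variable {N : ℕ} {P Q : ℕ → YoungDiagram}

theorem step (h : IsChain N P) (i : ℕ) : Step (P i) (P (i + 1)) := by
  rcases lt_or_ge i N with hi | hi
  · exact step_of_le_of_card (h.mono (by omega)) (by rw [h.card _ hi.le, h.card _ hi])
  · rw [h.const i hi, h.const (i + 1) (by omega)]
    exact .refl _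

theorem zero (h : IsChain N P) : P 0 = ⊥ := by
  have := h.card 0 (Nat.zero_le _)
  rw [YoungDiagram.card, Finset.card_eq_zero] at this
  exact YoungDiagram.ext (by simp [this])

theorem card_succ (h : IsChain N P) (i : ℕ) :
    (P (i + 1)).card = (P i).card + if i < N then 1 else 0 := by
  split_ifs with hi
  · rw [h.card _ hi.le, h.card _ hi]
  · rw [h.const i (by omega), h.const (i + 1) (by omega), add_zero]

/-- The growth diagram with prescribed top boundary values, computed backwards. -/
noncomputable def backGrowth (N : ℕ) (P Q : ℕ → YoungDiagram) (i j : ℕ) : YoungDiagram :=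
  if N ≤ i then P j else if N ≤ j then Q i else
    Classical.epsilon fun a => ∃ x, LocalRule a (backGrowth N P Q (i + 1) j)
      (backGrowth N P Q i (j + 1)) (backGrowth N P Q (i + 1) (j + 1)) x
  termination_by (N - i) + (N - j)

theorem exists_isGrowth (hP : IsChain N P) (hQ : IsChain N Q) (hPQ : P N = Q N) :
    ∃ x Λ, IsGrowth x Λ ∧ (∀ i j, N ≤ i → Λ i j = P j) ∧ ∀ i j, N ≤ j → Λ i j = Q i := by
  set Λ := backGrowth N P Q with hΛ
  have hl : ∀ i j, N ≤ i → Λ i j = P j := fun i j hi => by rw [hΛ, backGrowth, if_pos hi]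
  have hr : ∀ i j, N ≤ j → Λ i j = Q i := by
    intro i j hj
    rcases le_or_gt N i with hi | hi
    · rw [hl i j hi, hP.const j hj, hQ.const i hi, hPQ]
    · rw [hΛ, backGrowth, if_neg (by omega), if_pos hj]
  have hrule : ∀ d i j, (N - i) + (N - j) = d →
      ∃ x, LocalRule (Λ i j) (Λ (i + 1) j) (Λ i (j + 1)) (Λ (i + 1) (j + 1)) x := by
    intro d
    induction d using Nat.strong_induction_on with
    | _ d ih =>
      intro i j hd
      rcases le_or_gt N i with hi | hi
      · rw [hl _ _ hi, hl _ _ hi, hl (i + 1) _ (by omega), hl (i + 1) _ (by omega)]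
        rcases hP.step j with h | ⟨r, h⟩
        · rw [← h]; exact ⟨_, .const _⟩
        · exact ⟨_, .snd h⟩
      rcases le_or_gt N j with hj | hj
      · rw [hr _ _ hj, hr _ _ hj, hr _ (j + 1) (by omega), hr _ (j + 1) (by omega)]
        rcases hQ.step i with h | ⟨r, h⟩
        · rw [← h]; exact ⟨_, .const _⟩
        · exact ⟨_, .fst h⟩
      have e : Λ i j = Classical.epsilon fun a => ∃ x, LocalRule a (Λ (i + 1) j)
          (Λ i (j + 1)) (Λ (i + 1) (j + 1)) x := by
        rw [hΛ, backGrowth, if_neg (by omega), if_neg (by omega)]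
      rw [e]
      refine Classical.epsilon_spec (p := fun a => ∃ x, LocalRule a (Λ (i + 1) j)
          (Λ i (j + 1)) (Λ (i + 1) (j + 1)) x) (LocalRule.exists_bot ?_ ?_)
      · obtain ⟨x, h⟩ := ih _ (by omega) (i + 1) j rfl
        exact h.step_snd
      · obtain ⟨x, h⟩ := ih _ (by omega) i (j + 1) rfl
        exact h.step_fst
  choose x hx using fun i j => hrule _ i j rfl
  have hm : ∀ i, Monotone fun j => Λ i j := fun i =>
    monotone_nat_of_le_succ fun j => (hx i j).step_snd.le
  have hm' : ∀ j, Monotone fun i => Λ i j := fun j =>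
    monotone_nat_of_le_succ fun i => (hx i j).step_fst.le
  refine ⟨x, Λ, ⟨fun j => ?_, fun i => ?_, hx⟩, hl, hr⟩
  · refine le_bot_iff.1 ((hm 0 (le_max_left j N)).trans ?_)
    dsimp only
    rw [hr _ _ (le_max_right j N), hQ.zero]
  · refine le_bot_iff.1 ((hm' 0 (le_max_left i N)).trans ?_)
    dsimp only
    rw [hl _ _ (le_max_right i N), hP.zero]

end IsChain

theorem IsGrowth.isChain {x : ℕ → ℕ → ℕ} {Λ : ℕ → ℕ → YoungDiagram} {N : ℕ}
    (h : IsGrowth x Λ) (hx : ∀ i, ∑ b ∈ Finset.range N, x i b = if i < N then 1 else 0) :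
    IsChain N fun i => Λ i N := by
  refine ⟨h.monotone_left N, fun i hi => ?_, fun i hi => ?_⟩
  · induction i with
    | zero => rw [h.zero_left, card_bot]
    | succ i ih => rw [h.card_succ, hx, if_pos (by omega), ih (by omega)]
  · induction i, hi using Nat.le_induction with
    | base => rfl
    | succ i hi ih =>
      rw [← ih]
      have hc := h.card_succ i N
      rw [hx, if_neg (by omega), add_zero] at hc
      rcases h.step_left i N with h1 | ⟨r, h1⟩
      · exact h1.symm
      · have := h1.card
        omega

section Permutation

variable {N : ℕ}

/-- The permutation matrix of `σ`, extended by zeros. -/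
def permEntry (σ : Equiv.Perm (Fin N)) (i j : ℕ) : ℕ :=
  if ∃ k : Fin N, (k : ℕ) = i ∧ (σ k : ℕ) = j then 1 else 0

theorem permEntry_eq_one {σ : Equiv.Perm (Fin N)} {i j : ℕ} :
    permEntry σ i j = 1 ↔ ∃ k : Fin N, (k : ℕ) = i ∧ (σ k : ℕ) = j := by
  unfold permEntry
  split_ifs with h <;> simp [h]

theorem permEntry_le_one (σ : Equiv.Perm (Fin N)) (i j : ℕ) : permEntry σ i j ≤ 1 := by
  unfold permEntry
  split_ifs <;> simp

theorem permEntry_inv (σ : Equiv.Perm (Fin N)) (i j : ℕ) :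
    permEntry σ⁻¹ j i = permEntry σ i j := by
  unfold permEntry
  congr 1
  refine propext ⟨?_, ?_⟩
  · rintro ⟨k, rfl, rfl⟩
    exact ⟨σ⁻¹ k, rfl, by simp⟩
  · rintro ⟨k, rfl, rfl⟩
    exact ⟨σ k, rfl, by simp⟩

theorem permEntry_row_unique {σ : Equiv.Perm (Fin N)} {i j b : ℕ} (h : permEntry σ i j = 1)
    (hb : b ≠ j) : permEntry σ i b = 0 := by
  obtain ⟨k, rfl, rfl⟩ := permEntry_eq_one.1 h
  refine if_neg ?_
  rintro ⟨l, hl, rfl⟩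
  exact hb (by rw [Fin.ext hl])

theorem sum_permEntry (σ : Equiv.Perm (Fin N)) (i : ℕ) :
    ∑ b ∈ Finset.range N, permEntry σ i b = if i < N then 1 else 0 := by
  split_ifs with hi
  · have h1 : permEntry σ i (σ ⟨i, hi⟩) = 1 := permEntry_eq_one.2 ⟨⟨i, hi⟩, rfl, rfl⟩
    rw [Finset.sum_eq_single (σ ⟨i, hi⟩ : ℕ) (fun b _ hb => permEntry_row_unique h1 hb)
      (by simp), h1]
  · refine Finset.sum_eq_zero fun b _ => if_neg ?_
    rintro ⟨k, rfl, -⟩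
    exact hi k.2

theorem isGrowth_permEntry (σ : Equiv.Perm (Fin N)) :
    IsGrowth (permEntry σ) (growth (permEntry σ)) := by
  refine isGrowth_growth (permEntry_le_one σ) (fun i j b h hb => permEntry_row_unique h hb.ne)
    fun i j a h ha => ?_
  rw [← permEntry_inv] at h ⊢
  exact permEntry_row_unique h ha.ne

theorem isChain_growth_left (σ : Equiv.Perm (Fin N)) :
    IsChain N fun i => growth (permEntry σ) i N :=
  (isGrowth_permEntry σ).isChain (sum_permEntry σ)

theorem isChain_growth_right (σ : Equiv.Perm (Fin N)) :
    IsChain N fun j => growth (permEntry σ) N j :=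
  (isGrowth_permEntry σ).transpose.isChain fun i => by
    simp only [← permEntry_inv σ, sum_permEntry]

theorem growth_permEntry_injective {σ τ : Equiv.Perm (Fin N)}
    (h : ∀ i, growth (permEntry σ) i N = growth (permEntry τ) i N)
    (h' : ∀ j, growth (permEntry σ) N j = growth (permEntry τ) N j) : σ = τ := by
  have key := (isGrowth_permEntry σ).eq_of_boundary (isGrowth_permEntry τ) h' h
  refine Equiv.ext fun k => ?_
  have h1 : permEntry σ k (σ k) = 1 := permEntry_eq_one.2 ⟨k, rfl, rfl⟩
  rw [key _ k.2 _ (σ k).2] at h1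
  obtain ⟨l, hl, hl'⟩ := permEntry_eq_one.1 h1
  rw [Fin.ext hl] at hl'
  exact (Fin.ext hl').symm

theorem eq_permEntry {x : ℕ → ℕ → ℕ} (hx : ∀ i j, x i j ≤ 1)
    (hrow : ∀ i, ∑ b ∈ Finset.range N, x i b = if i < N then 1 else 0)
    (hcol : ∀ j, ∑ a ∈ Finset.range N, x a j = if j < N then 1 else 0)
    (h0 : ∀ i j, N ≤ i → x i j = 0) (h0' : ∀ i j, N ≤ j → x i j = 0) :
    ∃ σ : Equiv.Perm (Fin N), x = permEntry σ := by
  have uniq : ∀ f : ℕ → ℕ, ∑ b ∈ Finset.range N, f b ≤ 1 → ∀ a < N, ∀ b < N, f a = 1 →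
      f b = 1 → a = b := by
    intro f hf a ha b hb h1 h2
    by_contra hab
    have : ∑ c ∈ {a, b}, f c ≤ ∑ c ∈ Finset.range N, f c :=
      Finset.sum_le_sum_of_subset (by
        intro c hc
        simp only [Finset.mem_insert, Finset.mem_singleton] at hc
        rcases hc with rfl | rfl
        exacts [Finset.mem_range.2 ha, Finset.mem_range.2 hb])
    rw [Finset.sum_pair hab] at this
    omega
  have hex : ∀ i : Fin N, ∃ j : Fin N, x i j = 1 := by
    intro i
    have h1 : ∑ b ∈ Finset.range N, x i b ≠ 0 := by rw [hrow, if_pos i.2]; exact one_ne_zero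
    obtain ⟨b, hb, hb'⟩ := Finset.exists_ne_zero_of_sum_ne_zero h1
    have := hx i b
    exact ⟨⟨b, Finset.mem_range.1 hb⟩, by dsimp only; omega⟩
  choose g hg using hex
  have hinj : Function.Injective g := by
    intro i i' h
    have h1 := hg i
    rw [h] at h1
    refine Fin.ext (uniq (fun a => x a (g i')) ?_ i i.2 i' i'.2 h1 (hg i'))
    rw [hcol, if_pos (g i').2]
  refine ⟨Equiv.ofBijective g (Finite.injective_iff_bijective.1 hinj), ?_⟩
  funext i j
  unfold permEntry
  split_ifs with h
  · obtain ⟨k, rfl, rfl⟩ := h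
    exact hg k
  · by_contra hne
    have h1 : x i j = 1 := by have := hx i j; omega
    have hi : i < N := by by_contra! hi; exact hne (h0 i j hi)
    have hj : j < N := by by_contra! hj; exact hne (h0' i j hj)
    refine h ⟨⟨i, hi⟩, rfl, uniq (x i) ?_ _ (Fin.is_lt _) j hj (hg ⟨i, hi⟩) h1⟩
    rw [hrow, if_pos hi]

theorem exists_growth_permEntry_eq {P Q : ℕ → YoungDiagram} (hP : IsChain N P)
    (hQ : IsChain N Q) (hPQ : P N = Q N) : ∃ σ : Equiv.Perm (Fin N),
      (∀ i, growth (permEntry σ) i N = Q i) ∧ ∀ j, growth (permEntry σ) N j = P j := by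
  obtain ⟨x, Λ, h, hl, hr⟩ := hP.exists_isGrowth hQ hPQ
  have hcol : ∀ i j, N ≤ j → ∑ b ∈ Finset.range j, x i b = if i < N then 1 else 0 := by
    intro i j hj
    have h1 := h.card_succ i j
    have h2 := hQ.card_succ i
    rw [hr _ _ hj, hr _ _ hj] at h1
    omega
  have hrow : ∀ i j, N ≤ i → ∑ a ∈ Finset.range i, x a j = if j < N then 1 else 0 := by
    intro i j hi
    have h1 := h.transpose.card_succ j i
    have h2 := hP.card_succ j
    rw [hl _ _ hi, hl _ _ hi] at h1
    omega
  obtain ⟨σ, rfl⟩ := eq_permEntry (fun i j => (h.rule i j).entry_le_one)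
    (fun i => hcol i N le_rfl) (fun j => hrow N j le_rfl) (fun i j hi => by
      have h1 := hcol i (N + j + 1) (by omega)
      rw [if_neg (by omega)] at h1
      exact Finset.sum_eq_zero_iff.1 h1 j (Finset.mem_range.2 (by omega))) (fun i j hj => by
      have h1 := hrow (N + i + 1) j (by omega)
      rw [if_neg (by omega)] at h1
      exact Finset.sum_eq_zero_iff.1 h1 i (Finset.mem_range.2 (by omega)))
  exact ⟨σ, by rw [← h.unique (isGrowth_permEntry σ)]; exact
    ⟨fun i => hr i N le_rfl, fun j => hl N j le_rfl⟩⟩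

/-- `HasIncreasing σ i j k` says that `σ` has an increasing subsequence of length `k` among the
positions less than `i` and the values less than `j`. -/
def HasIncreasing (σ : Equiv.Perm (Fin N)) (i j k : ℕ) : Prop :=
  ∃ f : Fin k → Fin N, StrictMono f ∧ StrictMono (fun t => σ (f t)) ∧
    (∀ t, (f t : ℕ) < i) ∧ ∀ t, (σ (f t) : ℕ) < j

theorem HasIncreasing.mono {σ : Equiv.Perm (Fin N)} {i j i' j' k : ℕ}
    (h : HasIncreasing σ i j k) (hi : i ≤ i') (hj : j ≤ j') : HasIncreasing σ i' j' k := by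
  obtain ⟨f, h1, h2, h3, h4⟩ := h
  exact ⟨f, h1, h2, fun t => (h3 t).trans_le hi, fun t => (h4 t).trans_le hj⟩

theorem HasIncreasing.le_rowLen {σ : Equiv.Perm (Fin N)} {k i j : ℕ}
    (h : HasIncreasing σ i j k) : k ≤ (growth (permEntry σ) i j).rowLen 0 := by
  induction k generalizing i j with
  | zero => exact Nat.zero_le _
  | succ k ih =>
    obtain ⟨f, h1, h2, h3, h4⟩ := h
    have hG := isGrowth_permEntry σ
    set a := f (Fin.last k) with ha
    have hk : k ≤ (growth (permEntry σ) a (σ a)).rowLen 0 :=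
      ih ⟨fun t => f t.castSucc, h1.comp Fin.strictMono_castSucc,
        h2.comp Fin.strictMono_castSucc, fun t => h1 (Fin.castSucc_lt_last t),
        fun t => h2 (Fin.castSucc_lt_last t)⟩
    have hr := hG.rule a (σ a)
    have h5 := hr.rowLen_zero
    rw [permEntry_eq_one.2 ⟨a, rfl, rfl⟩] at h5
    have h6 := le_iff_rowLen.1 hr.step_fst.le 0
    have h7 := le_iff_rowLen.1 ((hG.monotone_left (σ a + 1) (h3 (Fin.last k))).trans
      (hG.transpose.monotone_left i (h4 (Fin.last k)))) 0
    simp only [Nat.succ_eq_add_one, ← ha] at h7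
    omega

theorem hasIncreasing_rowLen (σ : Equiv.Perm (Fin N)) (i j : ℕ) :
    HasIncreasing σ i j ((growth (permEntry σ) i j).rowLen 0) := by
  have hG := isGrowth_permEntry σ
  have hbot : (⊥ : YoungDiagram).rowLen 0 = 0 := by
    by_contra h
    exact notMem_bot _ (mem_iff_lt_rowLen.2 (Nat.pos_of_ne_zero h))
  have hzero : ∀ i j, HasIncreasing σ i j 0 := fun i j =>
    ⟨Fin.elim0, fun t => t.elim0, fun t => t.elim0, fun t => t.elim0, fun t => t.elim0⟩
  induction i generalizing j with
  | zero => rw [hG.zero_left, hbot]; exact hzero _ _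
  | succ i ih =>
    induction j with
    | zero => rw [hG.zero_right, hbot]; exact hzero _ _
    | succ j ihj =>
      have hr := hG.rule i j
      have h1 := hr.rowLen_zero
      rcases Nat.le_one_iff_eq_zero_or_eq_one.1 hr.entry_le_one with h0 | h0
      · rw [h0, add_zero] at h1
        rw [h1]
        rcases max_choice ((growth (permEntry σ) (i + 1) j).rowLen 0)
          ((growth (permEntry σ) i (j + 1)).rowLen 0) with h2 | h2 <;> rw [h2]
        · exact ihj.mono le_rfl (Nat.le_succ j)
        · exact (ih (j + 1)).mono (Nat.le_succ i) le_rfl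
      · rw [h0] at hr h1
        obtain ⟨e1, e2⟩ := hr.eq_of_entry_eq_one
        rw [h1, ← e1, ← e2, max_self]
        obtain ⟨f, h2, h3, h4, h5⟩ := ih j
        obtain ⟨a, rfl, rfl⟩ := permEntry_eq_one.1 h0
        refine ⟨Fin.snoc f a, ?_, ?_, ?_, ?_⟩
        · intro s t hst
          induction t using Fin.lastCases with
          | last =>
            induction s using Fin.lastCases with
            | last => exact absurd hst (lt_irrefl _)
            | cast s => simpa using h4 s
          | cast t =>
            induction s using Fin.lastCases with
            | last => exact absurd hst (Fin.castSucc_lt_last t).asymm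
            | cast s => simpa using h2 (Fin.castSucc_lt_castSucc_iff.1 hst)
        · intro s t hst
          induction t using Fin.lastCases with
          | last =>
            induction s using Fin.lastCases with
            | last => exact absurd hst (lt_irrefl _)
            | cast s => simpa using h5 s
          | cast t =>
            induction s using Fin.lastCases with
            | last => exact absurd hst (Fin.castSucc_lt_last t).asymm
            | cast s => simpa using h3 (Fin.castSucc_lt_castSucc_iff.1 hst)
        · intro t
          induction t using Fin.lastCases with
          | last => simp
          | cast t => simpa using (h4 t).trans (Nat.lt_succ_self _)
        · intro t
          induction t using Fin.lastCases with
          | last => simp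
          | cast t => simpa using (h5 t).trans (Nat.lt_succ_self _)

theorem lisLength_eq_rowLen (σ : Equiv.Perm (Fin N)) :
    lisLength σ = (growth (permEntry σ) N N).rowLen 0 := by
  refine IsGreatest.csSup_eq ⟨?_, ?_⟩
  · obtain ⟨f, h1, h2, -, -⟩ := hasIncreasing_rowLen σ N N
    exact ⟨f, h1, h2⟩
  · rintro k ⟨f, h1, h2⟩
    exact HasIncreasing.le_rowLen ⟨f, h1, h2, fun t => (f t).2, fun t => (σ (f t)).2⟩

end Permutation

section Tableaux

variable {μ : YoungDiagram}

/-- A standard filling of `μ` is a bijective filling by the numbers less than `μ.card`, increasing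
along rows and columns. -/
def IsStandard (f : μ.cells → Fin μ.card) : Prop :=
  Function.Bijective f ∧
    (∀ c₁ c₂ : μ.cells, (c₁ : ℕ × ℕ).1 = (c₂ : ℕ × ℕ).1 → (c₁ : ℕ × ℕ).2 < (c₂ : ℕ × ℕ).2 →
      f c₁ < f c₂) ∧
    (∀ c₁ c₂ : μ.cells, (c₁ : ℕ × ℕ).2 = (c₂ : ℕ × ℕ).2 → (c₁ : ℕ × ℕ).1 < (c₂ : ℕ × ℕ).1 →
      f c₁ < f c₂)

namespace IsStandard

variable {f : μ.cells → Fin μ.card}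

theorem monotone (h : IsStandard f) : Monotone f := by
  rintro ⟨⟨i, j⟩, h1⟩ ⟨⟨i', j'⟩, h2⟩ ⟨hi, hj⟩
  dsimp only at hi hj
  have h3 : (i, j') ∈ μ.cells := μ.up_left_mem hi le_rfl h2
  have e1 : f ⟨(i, j), h1⟩ ≤ f ⟨(i, j'), h3⟩ := by
    rcases hj.eq_or_lt with rfl | hj
    exacts [le_rfl, (h.2.1 ⟨(i, j), h1⟩ ⟨(i, j'), h3⟩ rfl hj).le]
  have e2 : f ⟨(i, j'), h3⟩ ≤ f ⟨(i', j'), h2⟩ := by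
    rcases hi.eq_or_lt with rfl | hi
    exacts [le_rfl, (h.2.2 ⟨(i, j'), h3⟩ ⟨(i', j'), h2⟩ rfl hi).le]
  exact e1.trans e2

/-- The diagram formed by the cells of a standard filling with entry less than `i`. -/
def sublevel (h : IsStandard f) (i : ℕ) : YoungDiagram where
  cells := (Finset.univ.filter fun c => (f c : ℕ) < i).map (Function.Embedding.subtype _)
  isLowerSet := by
    intro c d hdc hc
    simp only [Finset.coe_map, Set.mem_image, Finset.mem_coe, Finset.mem_filter,
      Finset.mem_univ, true_and] at hc ⊢
    obtain ⟨⟨c, hc⟩, hci, rfl⟩ := hc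
    exact ⟨⟨d, μ.isLowerSet hdc hc⟩, (Fin.le_def.1 (h.monotone hdc)).trans_lt hci, rfl⟩

theorem mem_sublevel (h : IsStandard f) {i : ℕ} {c : ℕ × ℕ} :
    c ∈ h.sublevel i ↔ ∃ hc : c ∈ μ.cells, (f ⟨c, hc⟩ : ℕ) < i := by
  rw [← mem_cells]
  simp [sublevel]

theorem sublevel_of_card_le (h : IsStandard f) {i : ℕ} (hi : μ.card ≤ i) : h.sublevel i = μ :=
  YoungDiagram.ext <| Finset.ext fun c => by
    rw [mem_cells, h.mem_sublevel]
    exact ⟨fun hc => hc.1, fun hc => ⟨hc, (f ⟨c, hc⟩).2.trans_le hi⟩⟩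

theorem isChain_sublevel (h : IsStandard f) : IsChain μ.card h.sublevel := by
  refine ⟨fun i j hij c hc => ?_, fun i hi => ?_, fun i hi => ?_⟩
  · obtain ⟨h1, h2⟩ := h.mem_sublevel.1 hc
    exact h.mem_sublevel.2 ⟨h1, h2.trans_le hij⟩
  · rw [YoungDiagram.card, sublevel, Finset.card_map,
      Finset.card_equiv (t := Finset.univ.filter fun k : Fin μ.card => (k : ℕ) < i)
        (Equiv.ofBijective f h.1) (by simp),
      ← Finset.card_map Fin.valEmbedding]
    convert Finset.card_range i
    ext k
    simp only [Finset.mem_map, Finset.mem_filter, Finset.mem_univ, true_and,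
      Fin.valEmbedding_apply, Finset.mem_range]
    exact ⟨by rintro ⟨k, hk, rfl⟩; exact hk, fun hk => ⟨⟨k, by omega⟩, hk, rfl⟩⟩
  · rw [h.sublevel_of_card_le hi, h.sublevel_of_card_le le_rfl]

theorem eq_of_sublevel {g : μ.cells → Fin μ.card} (hf : IsStandard f) (hg : IsStandard g)
    (h : hf.sublevel = hg.sublevel) : f = g := by
  have key : ∀ c i, (f c : ℕ) < i ↔ (g c : ℕ) < i := by
    rintro ⟨c, hc⟩ i
    have h1 := hf.mem_sublevel (i := i) (c := c)
    rw [h, hg.mem_sublevel] at h1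
    simpa [hc] using h1.symm
  exact funext fun c => Fin.ext (eq_of_forall_gt_iff (key c))

end IsStandard

theorem IsChain.exists_isStandard {P : ℕ → YoungDiagram} (h : IsChain μ.card P)
    (hμ : P μ.card = μ) : ∃ f : μ.cells → Fin μ.card, ∃ hf : IsStandard f, hf.sublevel = P := by
  classical
  have hmem : ∀ c : μ.cells, ∃ i, i < μ.card ∧ (c : ℕ × ℕ) ∈ P (i + 1) := by
    rintro ⟨c, hc⟩
    have h0 : 0 < μ.card := Finset.card_pos.2 ⟨c, hc⟩
    refine ⟨μ.card - 1, by omega, ?_⟩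
    rw [Nat.sub_add_cancel h0, hμ]
    exact hc
  let f : μ.cells → Fin μ.card := fun c => ⟨Nat.find (hmem c), (Nat.find_spec (hmem c)).1⟩
  have key : ∀ c i, (f c : ℕ) < i ↔ (c : ℕ × ℕ) ∈ P i := by
    intro c i
    refine ⟨fun hi => h.mono hi (Nat.find_spec (hmem c)).2, fun hi => ?_⟩
    by_contra! hlt
    rcases i with _ | i
    · rw [h.zero] at hi
      exact notMem_bot _ hi
    · exact Nat.find_min (hmem c) hlt ⟨by have := (f c).2; omega, hi⟩
  have hinj : Function.Injective f := by
    intro c d hcd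
    by_contra hne
    have hstep := h.card_succ (f c)
    rw [if_pos (f c).2] at hstep
    have hsub : insert (c : ℕ × ℕ) (insert (d : ℕ × ℕ) (P (f c)).cells) ⊆
        (P (f c + 1)).cells := by
      refine Finset.insert_subset ?_ (Finset.insert_subset ?_
        (cells_subset_iff.2 (h.mono (Nat.le_succ _))))
      · exact (key c _).1 (Nat.lt_succ_self _)
      · exact (key d _).1 (by rw [hcd]; exact Nat.lt_succ_self _)
    have hd : (d : ℕ × ℕ) ∉ (P (f c)).cells := fun hd =>
      lt_irrefl _ ((key d (f d)).2 (by rw [← hcd]; exact hd))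
    have hc : (c : ℕ × ℕ) ∉ insert (d : ℕ × ℕ) (P (f c)).cells := by
      rw [Finset.mem_insert, not_or]
      exact ⟨fun e => hne (Subtype.ext e), fun hc => lt_irrefl _ ((key c (f c)).2 hc)⟩
    have := Finset.card_le_card hsub
    rw [Finset.card_insert_of_notMem hc, Finset.card_insert_of_notMem hd] at this
    simp only [YoungDiagram.card] at hstep
    omega
  have hmono : Monotone f := by
    intro c d hcd
    have hd := (key d (f d + 1)).1 (Nat.lt_succ_self _)
    exact Fin.le_def.2 (Nat.lt_succ_iff.1 ((key c (f d + 1)).2 ((P _).isLowerSet hcd hd)))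
  have hf : IsStandard f := by
    refine ⟨(Fintype.bijective_iff_injective_and_card f).2 ⟨hinj, by simp⟩, ?_, ?_⟩
    · intro c d h1 h2
      exact (hmono ⟨h1.le, h2.le⟩).lt_of_ne (hinj.ne fun e => h2.ne (by rw [e]))
    · intro c d h1 h2
      exact (hmono ⟨h2.le, h1.le⟩).lt_of_ne (hinj.ne fun e => h2.ne (by rw [e]))
  refine ⟨f, hf, funext fun i => YoungDiagram.ext (Finset.ext fun c => ?_)⟩
  rw [mem_cells, mem_cells, hf.mem_sublevel]
  refine ⟨fun ⟨hc, hi⟩ => (key ⟨c, hc⟩ i).1 hi, fun hc => ?_⟩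
  have hcμ : c ∈ μ.cells := by
    rw [mem_cells, ← hμ, ← h.const _ (le_max_right i μ.card)]
    exact h.mono (le_max_left _ _) hc
  exact ⟨hcμ, (key ⟨c, hcμ⟩ i).2 hc⟩

/-- Standard fillings of `μ` correspond to saturated chains from `⊥` to `μ`. -/
noncomputable def standardEquivChain (μ : YoungDiagram) :
    {f : μ.cells → Fin μ.card // IsStandard f} ≃
      {P : ℕ → YoungDiagram // IsChain μ.card P ∧ P μ.card = μ} :=
  Equiv.ofBijective
    (fun f => ⟨f.2.sublevel, f.2.isChain_sublevel, f.2.sublevel_of_card_le le_rfl⟩)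
    ⟨fun f g h => Subtype.ext (f.2.eq_of_sublevel g.2 (congrArg Subtype.val h)),
      fun ⟨_, hP, hμ⟩ => by
        obtain ⟨f, hf, rfl⟩ := hP.exists_isStandard hμ
        exact ⟨⟨f, hf⟩, rfl⟩⟩

theorem sytCount_eq_card_chain (μ : YoungDiagram) :
    sytCount μ = Nat.card {P : ℕ → YoungDiagram // IsChain μ.card P ∧ P μ.card = μ} :=
  Nat.card_congr (standardEquivChain μ)

theorem finite_setOf_card_eq (N : ℕ) : {μ : YoungDiagram | μ.card = N}.Finite := by
  refine Set.Finite.of_finite_image (f := cells)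
    ((Finset.range N ×ˢ Finset.range N).powerset.finite_toSet.subset ?_)
    fun a _ b _ h => YoungDiagram.ext h
  rintro _ ⟨μ, rfl, rfl⟩
  rw [Finset.mem_coe, Finset.mem_powerset]
  rintro ⟨i, j⟩ hc
  rw [mem_cells] at hc
  have hrow : μ.rowLen i ≤ μ.card := by
    rw [rowLen_eq_card]; exact Finset.card_le_card (Finset.filter_subset _ _)
  have hcol : μ.colLen j ≤ μ.card := by
    rw [colLen_eq_card]; exact Finset.card_le_card (Finset.filter_subset _ _)
  rw [Finset.mem_product, Finset.mem_range, Finset.mem_range]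
  exact ⟨(mem_iff_lt_colLen.1 hc).trans_le hcol, (mem_iff_lt_rowLen.1 hc).trans_le hrow⟩

end Tableaux

section Correspondence

/-- The Robinson-Schensted correspondence: permutations with longest increasing subsequence of
length `l` correspond to pairs of chains ending at the same diagram with first row of
length `l`. -/
noncomputable def robinsonSchensted (N l : ℕ) : {σ : Equiv.Perm (Fin N) // lisLength σ = l} ≃
    {R : (ℕ → YoungDiagram) × (ℕ → YoungDiagram) // (IsChain N R.1 ∧ IsChain N R.2) ∧
      R.1 N = R.2 N ∧ (R.1 N).rowLen 0 = l} :=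
  Equiv.ofBijective
    (fun σ => ⟨(fun j => growth (permEntry σ.1) N j, fun i => growth (permEntry σ.1) i N),
      ⟨isChain_growth_right σ.1, isChain_growth_left σ.1⟩, rfl,
      (lisLength_eq_rowLen σ.1).symm.trans σ.2⟩)
    ⟨fun σ τ h => by
      have h1 := congrArg Subtype.val h
      exact Subtype.ext (growth_permEntry_injective (congrFun (congrArg Prod.snd h1))
        (congrFun (congrArg Prod.fst h1))),
    fun ⟨⟨P, Q⟩, ⟨hP, hQ⟩, hPQ, hl⟩ => by
      obtain ⟨σ, h1, h2⟩ := exists_growth_permEntry_eq hP hQ hPQ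
      refine ⟨⟨σ, ?_⟩, Subtype.ext (Prod.ext (funext h2) (funext h1))⟩
      rw [lisLength_eq_rowLen, h2]
      exact hl⟩

/-- Pairs of chains with a common endpoint, grouped according to that endpoint. -/
def chainPairEquivSigma (N : ℕ) (p : YoungDiagram → Prop) (t : Finset YoungDiagram)
    (ht : ∀ μ, μ ∈ t ↔ μ.card = N ∧ p μ) :
    {R : (ℕ → YoungDiagram) × (ℕ → YoungDiagram) // (IsChain N R.1 ∧ IsChain N R.2) ∧
      R.1 N = R.2 N ∧ p (R.1 N)} ≃
    Σ μ : t, {P : ℕ → YoungDiagram // IsChain N P ∧ P N = μ} ×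
      {P : ℕ → YoungDiagram // IsChain N P ∧ P N = μ} where
  toFun R := ⟨⟨R.1.1 N, (ht _).2 ⟨R.2.1.1.card N le_rfl, R.2.2.2⟩⟩,
    ⟨R.1.1, R.2.1.1, rfl⟩, ⟨R.1.2, R.2.1.2, R.2.2.1.symm⟩⟩
  invFun S := ⟨(S.2.1.1, S.2.2.1), ⟨S.2.1.2.1, S.2.2.2.1⟩,
    S.2.1.2.2.trans S.2.2.2.2.symm, by
      dsimp only
      rw [S.2.1.2.2]
      exact ((ht _).1 S.1.2).2⟩
  left_inv _ := rfl
  right_inv := by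
    rintro ⟨⟨μ, hμ⟩, ⟨P, hP, hPμ⟩, ⟨Q, hQ, hQμ⟩⟩
    dsimp only at hPμ hQμ
    subst hPμ
    rfl

theorem card_lisLength_eq_sum (N l : ℕ) (t : Finset YoungDiagram)
    (ht : ∀ μ, μ ∈ t ↔ μ.card = N ∧ μ.rowLen 0 = l) :
    Nat.card {σ : Equiv.Perm (Fin N) // lisLength σ = l} = ∑ μ ∈ t, sytCount μ ^ 2 := by
  have hfin : ∀ μ : t, Finite {P : ℕ → YoungDiagram // IsChain N P ∧ P N = μ} := by
    rintro ⟨μ, hμ⟩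
    obtain ⟨rfl, -⟩ := (ht μ).1 hμ
    exact Finite.of_equiv _ (standardEquivChain μ)
  rw [Nat.card_congr ((robinsonSchensted N l).trans
    (chainPairEquivSigma N (fun μ => μ.rowLen 0 = l) t ht)), Nat.card_sigma,
    ← Finset.sum_coe_sort t fun μ => sytCount μ ^ 2]
  refine Finset.sum_congr rfl ?_
  rintro ⟨μ, hμ⟩ -
  obtain ⟨rfl, -⟩ := (ht μ).1 hμ
  rw [Nat.card_prod, sytCount_eq_card_chain, sq]

end Correspondence

end YoungDiagram

/-- The number of permutations of `{1,…,N}` whose longest increasing subsequence has length `ℓ`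
equals the sum, over partitions `λ ⊢ N` (identified with Young diagrams `μ` with `N` cells)
whose first part `λ₁ = μ.rowLen 0` equals `ℓ`, of the square of the number of standard Young
tableaux of shape `λ`.  Equivalently, for a uniformly random permutation,
`Prob(L = ℓ) = ∑_{λ ⊢ N, λ₁ = ℓ} (f_λ)² / N!`. -/
theorem lis_distribution_plancherel (N ℓ : ℕ) :
    (Nat.card {σ : Equiv.Perm (Fin N) // lisLength σ = ℓ} =
      ∑ᶠ (μ : YoungDiagram) (_ : μ.card = N ∧ μ.rowLen 0 = ℓ), sytCount μ ^ 2) ∧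
    ((Nat.card {σ : Equiv.Perm (Fin N) // lisLength σ = ℓ} : ℚ) / N ! =
      ∑ᶠ (μ : YoungDiagram) (_ : μ.card = N ∧ μ.rowLen 0 = ℓ),
        (sytCount μ : ℚ) ^ 2 / N !) := by
  obtain ⟨t, ht⟩ : ∃ t : Finset YoungDiagram, ∀ μ, μ ∈ t ↔ μ.card = N ∧ μ.rowLen 0 = ℓ := by
    have hfin := YoungDiagram.finite_setOf_card_eq N
    refine ⟨{μ ∈ hfin.toFinset | μ.rowLen 0 = ℓ}, fun μ => ?_⟩
    simp
  have hcard := YoungDiagram.card_lisLength_eq_sum N ℓ t ht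
  rw [finsum_cond_eq_sum_of_cond_iff _ fun {μ} _ => (ht μ).symm,
    finsum_cond_eq_sum_of_cond_iff _ fun {μ} _ => (ht μ).symm]
  refine ⟨hcard, ?_⟩
  rw [hcard, ← Finset.sum_div]
  push_cast
  rfl
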